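/- For every fixed integer k ≥ 0, the ratio p_{n;≤n−k}/(n+1)^{n−1} converges as n → ∞, and lim_{n→∞} p_{n;≤n−k}/(n+1)^{n−1} = Σ_{i=0}^{k} [(−1)^i (k+1−i)^i / i!] e^{−i}. -/

import Mathlib

/-- A parking function of length `n`: a sequence of positive integers whose
nondecreasing rearrangement `b` satisfies `b i ≤ i` (1-indexed). -/
def IsParkingFunction (n : ℕ) (a : Fin n → ℕ) : Prop :=
  (∀ i, 1 ≤ a i) ∧
  ∃ σ : Equiv.Perm (Fin n), Monotone (a ∘ σ) ∧ ∀ i : Fin n, a (σ i) ≤ (i : ℕ) + 1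

/-- A parking function of length `n` with `m ≥ n` parking spaces: entries in `[1,m]`
whose nondecreasing rearrangement `b` satisfies `b i ≤ m - n + i` (1-indexed). -/
def IsParkingFunctionWith (n m : ℕ) (a : Fin n → ℕ) : Prop :=
  (∀ i, 1 ≤ a i ∧ a i ≤ m) ∧
  ∃ σ : Equiv.Perm (Fin n), Monotone (a ∘ σ) ∧ ∀ i : Fin n, a (σ i) ≤ m - n + ((i : ℕ) + 1)

/-- `pN n` = number of parking functions of length `n` (so `pN n = (n+1)^(n-1)`). -/
noncomputable def pN (n : ℕ) : ℕ := Nat.card {a : Fin n → ℕ // IsParkingFunction n a}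

/-- `pWith n m` = `p_{n,m;≤m}`, the number of parking functions of length `n`
with `m` parking spaces. -/
noncomputable def pWith (n m : ℕ) : ℕ := Nat.card {a : Fin n → ℕ // IsParkingFunctionWith n m a}

/-- `pLe n s` = `p_{n;≤s}`, the number of parking functions of length `n`
all of whose entries are at most `s`. -/
noncomputable def pLe (n s : ℕ) : ℕ :=
  Nat.card {a : Fin n → ℕ // IsParkingFunction n a ∧ ∀ i, a i ≤ s}

/-- `pEq n s` = `p_{n;=s} = p_{n;≤s} - p_{n;≤s-1}` (with `p_{n;≤s} = 0` for `s < 0`). -/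
noncomputable def pEq (n s : ℕ) : ℕ := pLe n s - (if s = 0 then 0 else pLe n (s - 1))

/-- `pLeL n s l` = `p_{n;≤s}^l`, the number of parking functions of length `n` with all
entries at most `s` and first entry equal to `l`. -/
noncomputable def pLeL (n s l : ℕ) : ℕ :=
  Nat.card {a : Fin n → ℕ //
    IsParkingFunction n a ∧ (∀ i, a i ≤ s) ∧ (List.ofFn a).head? = some l}

/-- `pL n l` = `p_n^l`, the number of parking functions of length `n` with first entry `l`. -/
noncomputable def pL (n l : ℕ) : ℕ :=
  Nat.card {a : Fin n → ℕ //
    IsParkingFunction n a ∧ (List.ofFn a).head? = some l}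

/-- `pEqL n s l` = `p_{n;=s}^l = p_{n;≤s}^l - p_{n;≤s-1}^l`. -/
noncomputable def pEqL (n s l : ℕ) : ℕ := pLeL n s l - (if s = 0 then 0 else pLeL n (s - 1) l)

/-- Simulate the parking process with `m` spaces: cars arrive in order with the given
preference list, each parks in the first free space among `pref, pref+1, …, m` if any;
returns the number of cars that leave unparked, given the set `occ` of occupied spaces. -/
def flawCount (m : ℕ) : List ℕ → Finset ℕ → ℕ
  | [], _ => 0
  | p :: rest, occ =>
    match (List.range' p (m + 1 - p)).find? (fun s => decide (s ∉ occ)) with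
    | some s => flawCount m rest (insert s occ)
    | none => flawCount m rest occ + 1

/-- `pFlaw n m k` = `p_{n,m;≤m;k}`, the number of `k`-flaw preference sets of length `n`
with `m` parking spaces and all entries in `[1,m]`. -/
noncomputable def pFlaw (n m k : ℕ) : ℕ :=
  Nat.card {a : Fin n → ℕ //
    (∀ i, 1 ≤ a i ∧ a i ≤ m) ∧ flawCount m (List.ofFn a) ∅ = k}

/-- `P(x) = Σ_{n≥0} (n+1)^(n-1) xⁿ/n!` in `ℚ[[x]]`. -/
noncomputable def Pser : PowerSeries ℚ :=
  PowerSeries.mk fun n => ((n : ℚ) + 1) ^ (n - 1) / n.factorial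

/-- `Q_k(x) = Σ_{n≥0} p_{n,n+k;≤n+k} xⁿ/n!` in `ℚ[[x]]`. -/
noncomputable def Qser (k : ℕ) : PowerSeries ℚ :=
  PowerSeries.mk fun n => (pWith n (n + k) : ℚ) / n.factorial

/-- `R_k(x) = Σ_{n≥k} p_{n;≤n-k} xⁿ/n!` in `ℚ[[x]]`. -/
noncomputable def Rser (k : ℕ) : PowerSeries ℚ :=
  PowerSeries.mk fun n => if n < k then 0 else (pLe n (n - k) : ℚ) / n.factorial

/-- `H_k(x) = Σ_{n≥k} p_{n;=n-k} xⁿ/n!` in `ℚ[[x]]`. -/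
noncomputable def Hser (k : ℕ) : PowerSeries ℚ :=
  PowerSeries.mk fun n => if n < k then 0 else (pEq n (n - k) : ℚ) / n.factorial

/-- `T_k(x) = Σ_{n≥k+1} p_n^{n-k} xⁿ/(n-1)!` in `ℚ[[x]]`. -/
noncomputable def Tser (k : ℕ) : PowerSeries ℚ :=
  PowerSeries.mk fun n => if n < k + 1 then 0 else (pL n (n - k) : ℚ) / (n - 1).factorial

/-- `F_{k,s}(x) = Σ_{n≥s+1} p_{n;≤n-k}^{n-s} xⁿ/(n-1)!` in `ℚ[[x]]`. -/
noncomputable def Fser (k s : ℕ) : PowerSeries ℚ :=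
  PowerSeries.mk fun n =>
    if n < s + 1 then 0 else (pLeL n (n - k) (n - s) : ℚ) / (n - 1).factorial

open Finset in
theorem pf_iff (n : ℕ) (a : Fin n → ℕ) : IsParkingFunction n a ↔
    (∀ i, 1 ≤ a i) ∧ ∀ j ≤ n, j ≤ #{x | a x ≤ j} := by
  unfold IsParkingFunction
  refine and_congr_right fun _ => ⟨?_, ?_⟩
  · rintro ⟨σ, -, h⟩ j hj
    have : ((univ : Finset (Fin j)).map ((Fin.castLEEmb hj).trans σ.toEmbedding)) ⊆
        univ.filter (fun x => a x ≤ j) := by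
      intro x hx
      simp only [mem_map, mem_univ, true_and] at hx
      obtain ⟨i, rfl⟩ := hx
      simp only [mem_filter, mem_univ, true_and]
      have := h (Fin.castLE hj i)
      have h2 := i.2
      simp at this ⊢
      omega
    have := card_le_card this
    simpa using this
  · intro h
    refine ⟨Tuple.sort a, Tuple.monotone_sort a, ?_⟩
    intro i
    by_contra hc
    push Not at hc
    have h1 := h (i + 1) (by omega)
    have : univ.filter (fun x => a x ≤ i + 1) ⊆ (Finset.Iio i).map (Tuple.sort a).toEmbedding := by
      intro x hx
      simp only [mem_filter, mem_univ, true_and] at hx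
      simp only [mem_map, mem_Iio]
      refine ⟨(Tuple.sort a).symm x, ?_, by simp⟩
      by_contra hh
      push Not at hh
      have := Tuple.monotone_sort a hh
      simp at this
      omega
    have := card_le_card this
    simp at this
    omega

open Finset in
/-- good functions -/
def gd (α : Type) [Fintype α] [DecidableEq α] (s : ℕ) : Finset (α → ℕ) :=
  (Fintype.piFinset fun _ => Icc 1 s).filter fun f => ∀ j ≤ s, j ≤ #{x | f x ≤ j}

open Finset in
theorem pLe_eq (n s : ℕ) (hs : s ≤ n) : pLe n s = (gd (Fin n) s).card := by
  unfold pLe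
  rw [← Nat.card_eq_finsetCard]
  refine Nat.card_congr (Equiv.subtypeEquivRight fun a => ?_)
  rw [pf_iff]
  simp only [gd, mem_filter, Fintype.mem_piFinset, mem_Icc]
  constructor
  · rintro ⟨⟨h1, h2⟩, h3⟩
    exact ⟨fun x => ⟨h1 x, h3 x⟩, fun j hj => h2 j (hj.trans hs)⟩
  · rintro ⟨h1, h2⟩
    refine ⟨⟨fun x => (h1 x).1, fun j hj => ?_⟩, fun x => (h1 x).2⟩
    rcases le_total j s with h | h
    · exact h2 j h
    · have : univ.filter (fun x => a x ≤ j) = univ :=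
        filter_true_of_mem fun x _ => (h1 x).2.trans h
      rw [this]; simpa using hj

open Finset in
theorem gd_congr (α β : Type) [Fintype α] [DecidableEq α] [Fintype β] [DecidableEq β]
    (e : α ≃ β) (s : ℕ) : (gd α s).card = (gd β s).card := by
  have key : ∀ (α β : Type) [Fintype α] [DecidableEq α] [Fintype β] [DecidableEq β]
    (e : α ≃ β) (f : α → ℕ), f ∈ gd α s → f ∘ e.symm ∈ gd β s := by
    intro α β _ _ _ _ e f hf
    simp only [gd, mem_filter, Fintype.mem_piFinset] at hf ⊢
    refine ⟨fun x => hf.1 _, fun j hj => (hf.2 j hj).trans (le_of_eq ?_)⟩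
    apply card_bij (fun x _ => e x)
    · simp
    · simp
    · intro b hb
      exact ⟨e.symm b, by simpa using hb, by simp⟩
  refine card_nbij' (fun f => f ∘ e.symm) (fun f => f ∘ e) (fun f hf => key _ _ e f hf)
    (fun f hf => key _ _ e.symm f hf) ?_ ?_
  · intro f _; ext; simp
  · intro f _; ext; simp

open Finset in
/-- functions whose first failure is at `i+1` -/
def bd (n s i : ℕ) : Finset (Fin n → ℕ) :=
  (Fintype.piFinset fun _ => Icc 1 s).filter fun f =>
    (∀ j ≤ i, j ≤ #{x | f x ≤ j}) ∧ #{x | f x ≤ i + 1} ≤ i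

open Finset in
theorem fiber (n s i : ℕ) (hi : i < s) (A : Finset (Fin n)) (hA : A.card = i) :
    ((bd n s i).filter fun f => univ.filter (fun x => f x ≤ i) = A).card =
      (gd (Fin i) i).card * (s - i - 1) ^ (n - i) := by
  have e : {x // x ∈ A} ≃ Fin i := A.equivFinOfCardEq hA
  rw [← gd_congr _ _ e]
  have h2 : (s - i - 1) ^ (n - i) =
      (Fintype.piFinset fun _ : {x // ¬ x ∈ A} => Icc (i + 2) s).card := by
    rw [Fintype.card_piFinset]
    simp [hA, Nat.sub_sub]
  rw [h2, ← card_product]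
  have cnt : ∀ (f : Fin n → ℕ), (∀ x, x ∉ A → i < f x) → ∀ j ≤ i,
      #{x | f x ≤ j} = #{x : {x // x ∈ A} | f x ≤ j} := by
    intro f hf j hj
    symm
    apply card_bij (fun x _ => x.1)
    · simp
    · intro a _ b _ h; exact Subtype.ext h
    · intro b hb
      simp only [mem_filter, mem_univ, true_and] at hb
      have : b ∈ A := by by_contra h; have := hf b h; omega
      exact ⟨⟨b, this⟩, by simpa using hb, rfl⟩
  refine card_nbij' (fun f => (fun x => f x, fun x => f x))
    (fun p x => if h : x ∈ A then p.1 ⟨x, h⟩ else p.2 ⟨x, h⟩) ?_ ?_ ?_ ?_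
  · intro f hf
    simp only [bd, gd, coe_filter, mem_filter, Set.mem_ofPred_eq, Fintype.mem_piFinset, mem_Icc, coe_product, Set.mem_prod, mem_coe] at hf ⊢
    obtain ⟨⟨h1, h3, h4⟩, h5⟩ := hf
    have hA' : ∀ x, x ∈ A ↔ f x ≤ i := by intro x; simp [← h5]
    refine ⟨⟨fun x => ⟨(h1 _).1, (hA' _).1 x.2⟩, fun j hj => ?_⟩, fun x => ⟨?_, (h1 _).2⟩⟩
    · rw [← cnt f (fun x hx => by rw [hA'] at hx; omega) j hj]
      exact h3 j hj
    · have h6 := x.2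
      rw [hA'] at h6
      have : univ.filter (fun x => f x ≤ i) = univ.filter (fun x => f x ≤ i + 1) := by
        apply eq_of_subset_of_card_le
        · intro y hy; simp at hy ⊢; omega
        · rw [h5, hA]; exact h4
      by_contra hc
      have h7 : x.1 ∈ univ.filter (fun x => f x ≤ i + 1) := by simp; omega
      rw [← this] at h7
      simp at h7
      omega
  · rintro ⟨g, h⟩ hp
    simp only [bd, gd, coe_filter, mem_filter, Set.mem_ofPred_eq, Fintype.mem_piFinset, mem_Icc, coe_product, Set.mem_prod, mem_coe] at hp ⊢
    obtain ⟨⟨h1, h3⟩, h4⟩ := hp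
    set f : Fin n → ℕ := fun x => if h' : x ∈ A then g ⟨x, h'⟩ else h ⟨x, h'⟩ with hf
    have fA : ∀ x (hx : x ∈ A), f x = g ⟨x, hx⟩ := fun x hx => by simp [hf, hx]
    have fB : ∀ x (hx : x ∉ A), f x = h ⟨x, hx⟩ := fun x hx => by simp [hf, hx]
    have eA : ∀ j, i ≤ j → j ≤ i + 1 → univ.filter (fun x => f x ≤ j) = A := by
      intro j hj hj'
      ext x
      simp only [mem_filter, mem_univ, true_and]
      by_cases hx : x ∈ A
      · have := h1 ⟨x, hx⟩
        rw [fA x hx]; simp only [hx, iff_true]; omega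
      · have := h4 ⟨x, hx⟩
        rw [fB x hx]; simp only [hx, iff_false]; omega
    refine ⟨⟨fun x => ?_, fun j hj => ?_, ?_⟩, eA i (by omega) (by omega)⟩
    · change 1 ≤ f x ∧ f x ≤ s
      by_cases hx : x ∈ A
      · have := h1 ⟨x, hx⟩
        rw [fA x hx]; omega
      · have := h4 ⟨x, hx⟩
        rw [fB x hx]; omega
    · rw [cnt f (fun x hx => by rw [fB x hx]; have := h4 ⟨x, hx⟩; omega) j hj]
      have : (fun x : {x // x ∈ A} => f x) = g := by ext x; exact fA x.1 x.2
      refine (h3 j hj).trans (le_of_eq ?_)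
      rw [← this]
    · rw [eA (i + 1) (by omega) le_rfl, hA]
  · intro f _; ext x; simp
  · rintro ⟨g, h⟩ _
    refine Prod.ext ?_ ?_
    · ext x; simp
    · ext x; simp [x.2]

open Finset in
theorem bd_card (n s i : ℕ) (hi : i < s) :
    (bd n s i).card = n.choose i * ((gd (Fin i) i).card * (s - i - 1) ^ (n - i)) := by
  rw [card_eq_sum_card_fiberwise (f := fun f => univ.filter (fun x => f x ≤ i))
    (t := powersetCard i univ)]
  · rw [sum_congr rfl (fun A hA => fiber n s i hi A (mem_powersetCard.1 hA).2)]
    simp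
  · intro f hf
    simp only [bd, coe_filter, Set.mem_ofPred_eq] at hf
    simp only [mem_coe, mem_powersetCard, subset_univ, true_and]
    refine le_antisymm (le_trans (card_le_card ?_) hf.2.2) (hf.2.1 i le_rfl)
    intro y hy; simp at hy ⊢; omega

open Finset in
theorem recur (n s : ℕ) :
    s ^ n = (gd (Fin n) s).card +
      ∑ i ∈ range s, n.choose i * ((gd (Fin i) i).card * (s - i - 1) ^ (n - i)) := by
  rw [← sum_congr rfl (fun i hi => bd_card n s i (mem_range.1 hi)), ← card_biUnion]
  · have : s ^ n = (Fintype.piFinset fun _ : Fin n => Icc 1 s).card := by simp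
    rw [this, gd, ← card_filter_add_card_filter_not (fun f => ∀ j ≤ s, j ≤ #{x | f x ≤ j})]
    congr 2
    ext f
    simp only [mem_filter, mem_biUnion, mem_range, bd]
    constructor
    · rintro ⟨h1, h2⟩
      push Not at h2
      classical
      have h3 := Nat.find_spec h2
      have h4 := fun m => Nat.find_min (m := m) h2
      obtain ⟨i, hi⟩ : ∃ i, Nat.find h2 = i + 1 :=
        Nat.exists_eq_succ_of_ne_zero (by intro h; rw [h] at h3; omega)
      rw [hi] at h3 h4
      refine ⟨i, by omega, h1, fun j hj => ?_, by omega⟩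
      have := h4 j (by omega)
      push Not at this
      exact this (by omega)
    · rintro ⟨i, hi, h1, h2, h3⟩
      refine ⟨h1, fun h => ?_⟩
      have := h (i + 1) (by omega)
      omega
  · intro i _ j _ hij
    rw [Function.onFun, disjoint_left]
    intro f hf hf'
    simp only [bd, mem_filter] at hf hf'
    rcases lt_or_gt_of_ne hij with h | h
    · have := hf'.2.1 (i + 1) (by omega)
      omega
    · have := hf.2.1 (j + 1) (by omega)
      omega

open Finset in
theorem abel0 (n : ℕ) : ∑ i ∈ range (n + 2),
    ((n + 1).choose i : ℝ) * ((i : ℝ) + 1) ^ (i - 1) * (0 - i - 1) ^ (n + 1 - i) = 0 := by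
  have h := fwdDiff_iter_eq_sum_shift (1 : ℝ) (fun x : ℝ => x ^ n) (n + 1) 1
  have h0 : (fwdDiff (1 : ℝ))^[n + 1] (fun x : ℝ => x ^ n) = 0 :=
    fwdDiff_iter_pow_eq_zero_of_lt (by omega)
  rw [h0] at h
  simp only [Pi.zero_apply] at h
  refine Eq.trans ?_ h.symm
  refine sum_congr rfl fun i hi => ?_
  rw [mem_range] at hi
  have : (0 - (i : ℝ) - 1) = (-1) * ((i : ℝ) + 1) := by ring
  rw [this, mul_pow]
  simp only [zsmul_eq_mul, nsmul_eq_mul, mul_one]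
  push_cast
  rcases Nat.eq_zero_or_pos i with rfl | hi'
  · simp
  · have : ((i : ℝ) + 1) ^ (i - 1) * ((i : ℝ) + 1) ^ (n + 1 - i) = (1 + (i : ℝ)) ^ n := by
      rw [← pow_add, add_comm (1 : ℝ)]; congr 1; omega
    rw [← this]; ring

open Finset in
theorem abel (n : ℕ) : ∀ z : ℝ, z ^ n = ∑ i ∈ range (n + 1),
    (n.choose i : ℝ) * ((i : ℝ) + 1) ^ (i - 1) * (z - i - 1) ^ (n - i) := by
  induction n with
  | zero => simp
  | succ n ih =>
    have hd : ∀ z : ℝ, HasDerivAt (fun z : ℝ => z ^ (n + 1) - ∑ i ∈ range (n + 1 + 1),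
        ((n + 1).choose i : ℝ) * ((i : ℝ) + 1) ^ (i - 1) * (z - i - 1) ^ (n + 1 - i)) 0 z := by
      intro z
      have h1 : HasDerivAt (fun z : ℝ => z ^ (n + 1)) (((n + 1 : ℕ) : ℝ) * z ^ n) z := by
        simpa using hasDerivAt_pow (n + 1) z
      have h2 : HasDerivAt (fun z : ℝ => ∑ i ∈ range (n + 1 + 1),
        ((n + 1).choose i : ℝ) * ((i : ℝ) + 1) ^ (i - 1) * (z - i - 1) ^ (n + 1 - i))
        (∑ i ∈ range (n + 1 + 1), ((n + 1).choose i : ℝ) * ((i : ℝ) + 1) ^ (i - 1) *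
          (((n + 1 - i : ℕ) : ℝ) * (z - i - 1) ^ (n + 1 - i - 1) * 1)) z := by
        apply HasDerivAt.fun_sum
        intro i _
        apply HasDerivAt.const_mul
        exact (((hasDerivAt_id z).sub_const _).sub_const _).pow _
      have h3 := h1.sub h2
      refine h3.congr_deriv ?_
      rw [sum_range_succ, ih z, mul_sum]
      simp only [Nat.sub_self, Nat.cast_zero, zero_mul, mul_zero, add_zero]
      rw [sub_eq_zero]
      refine sum_congr rfl fun i hi => ?_
      have h4 : (n.choose i : ℝ) * ((n + 1 : ℕ) : ℝ) = ((n + 1).choose i : ℝ) * ((n + 1 - i : ℕ) : ℝ) := by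
        exact_mod_cast Nat.choose_mul_succ_eq n i
      have h5 : n + 1 - i - 1 = n - i := by omega
      rw [h5]
      linear_combination ((i : ℝ) + 1) ^ (i - 1) * (z - i - 1) ^ (n - i) * h4
    intro z
    have := is_const_of_deriv_eq_zero (fun z => (hd z).differentiableAt) (fun z => (hd z).deriv) z 0
    have h0 := abel0 n
    beta_reduce at this
    rw [h0] at this
    simp at this
    linarith

open Filter Topology in
theorem lim_term (j : ℕ) : Tendsto (fun n : ℕ => (n.choose j : ℝ) * ((n : ℝ) + 1 - j) ^ (n - j - 1) /
    ((n : ℝ) + 1) ^ (n - 1)) atTop (𝓝 (Real.exp (-(j : ℝ)) / j.factorial)) := by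
  have h1 : Tendsto (fun n : ℕ => (1 + (-(j : ℝ)) / ((n + 1 : ℕ) : ℝ)) ^ (n + 1)) atTop
      (𝓝 (Real.exp (-(j : ℝ)))) :=
    (Real.tendsto_one_add_div_pow_exp (-(j : ℝ))).comp (tendsto_add_atTop_nat 1)
  have h2 : Tendsto (fun n : ℕ => (n.choose j : ℝ) / (n : ℝ) ^ j) atTop
      (𝓝 (1 / (j.factorial : ℝ))) := by
    have h := (isEquivalent_choose j)
    have hne : ∀ᶠ n : ℕ in atTop, ((n : ℝ) ^ j / j.factorial) ≠ 0 := by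
      filter_upwards [eventually_gt_atTop 0] with n hn
      positivity
    have h' := ((Asymptotics.isEquivalent_iff_tendsto_one hne).1 h).mul_const (1 / (j.factorial : ℝ))
    rw [one_mul] at h'
    refine h'.congr' ?_
    filter_upwards [eventually_gt_atTop 0] with n hn
    have : (n : ℝ) ≠ 0 := by positivity
    simp only [Pi.div_apply]
    field_simp
  have h3 : Tendsto (fun n : ℕ => ((n : ℝ) + 1 - j)) atTop atTop := by
    have : (fun n : ℕ => ((n : ℝ) + 1 - j)) = fun n : ℕ => (n : ℝ) + (1 - j) := by ext; ring
    rw [this]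
    exact tendsto_atTop_add_const_right _ _ tendsto_natCast_atTop_atTop
  have h4 : ∀ c : ℝ, Tendsto (fun n : ℕ => ((n : ℝ) + 1 - j + c) / ((n : ℝ) + 1 - j)) atTop (𝓝 1) := by
    intro c
    have : Tendsto (fun n : ℕ => 1 + c / ((n : ℝ) + 1 - j)) atTop (𝓝 (1 + 0)) :=
      tendsto_const_nhds.add (tendsto_const_nhds.div_atTop h3)
    rw [add_zero] at this
    refine this.congr' ?_
    filter_upwards [h3.eventually_gt_atTop 0] with n hn
    field_simp
  have h5 := ((h1.mul h2).mul ((h4 (j - 1)).pow j)).mul ((h4 j).pow 2)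
  have e : Real.exp (-(j : ℝ)) * (1 / (j.factorial : ℝ)) * 1 ^ j * 1 ^ 2 =
    Real.exp (-(j : ℝ)) / j.factorial := by simp; ring
  rw [e] at h5
  refine h5.congr' ?_
  filter_upwards [eventually_gt_atTop (j + 1)] with n hn
  obtain ⟨m, rfl⟩ : ∃ m, n = m + j + 1 := ⟨n - j - 1, by omega⟩
  have e1 : m + j + 1 - j - 1 = m := by omega
  have e2 : m + j + 1 - 1 = m + j := by omega
  rw [e1, e2]
  have p1 : ((m + j + 1 : ℕ) : ℝ) + 1 - j = m + 2 := by push_cast; ring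
  have p3 : (m : ℝ) + 2 + (j - 1) = ((m + j + 1 : ℕ) : ℝ) := by push_cast; ring
  have p4 : (m : ℝ) + 2 + j = ((m + j + 1 : ℕ) : ℝ) + 1 := by push_cast; ring
  have p2 : (1 + (-(j : ℝ)) / ((m + j + 1 + 1 : ℕ) : ℝ)) = (m + 2) / (((m + j + 1 : ℕ) : ℝ) + 1) := by
    push_cast
    field_simp
    ring
  rw [p2, p1, p3, p4]
  have q1 : ((m + j + 1 : ℕ) : ℝ) ≠ 0 := by positivity
  have q2 : ((m + j + 1 : ℕ) : ℝ) + 1 ≠ 0 := by positivity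
  have q3 : (m : ℝ) + 2 ≠ 0 := by positivity
  generalize ((m + j + 1).choose j : ℝ) = C
  generalize ((m + j + 1 : ℕ) : ℝ) = N at *
  rw [div_pow, div_pow, div_pow]
  field_simp
  ring

open Finset in
theorem gd_diag (n : ℕ) : ((gd (Fin n) n).card : ℝ) = ((n : ℝ) + 1) ^ (n - 1) := by
  induction n using Nat.strong_induction_on with
  | _ n ih =>
    have h1 : (n : ℝ) ^ n = (gd (Fin n) n).card + ∑ i ∈ range n,
        (n.choose i : ℝ) * ((gd (Fin i) i).card * ((n - i - 1 : ℕ) : ℝ) ^ (n - i)) := by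
      exact_mod_cast recur n n
    have h2 := abel n n
    rw [sum_range_succ] at h2
    simp only [Nat.choose_self, Nat.sub_self, pow_zero, mul_one, Nat.cast_one, one_mul] at h2
    have h3 : ∑ i ∈ range n,
        (n.choose i : ℝ) * ((gd (Fin i) i).card * ((n - i - 1 : ℕ) : ℝ) ^ (n - i)) =
        ∑ i ∈ range n, (n.choose i : ℝ) * ((i : ℝ) + 1) ^ (i - 1) * ((n : ℝ) - i - 1) ^ (n - i) := by
      refine sum_congr rfl fun i hi => ?_
      rw [mem_range] at hi
      rw [ih i hi, Nat.sub_sub, Nat.cast_sub (by omega)]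
      push_cast
      ring
    linarith

open Finset in
theorem pLe_formula (n k : ℕ) (hk : k ≤ n) : (pLe n (n - k) : ℝ) =
    ∑ j ∈ range (k + 1), (n.choose j : ℝ) * ((n : ℝ) + 1 - j) ^ (n - j - 1) *
      ((-1) ^ j * ((k : ℝ) + 1 - j) ^ j) := by
  obtain ⟨s, rfl⟩ : ∃ s, n = s + k := ⟨n - k, by omega⟩
  rw [Nat.add_sub_cancel, pLe_eq _ _ (by omega)]
  have h1 : (s : ℝ) ^ (s + k) = (gd (Fin (s + k)) s).card + ∑ i ∈ range s,
      ((s + k).choose i : ℝ) * ((gd (Fin i) i).card * ((s - i - 1 : ℕ) : ℝ) ^ (s + k - i)) := by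
    exact_mod_cast recur (s + k) s
  have h2 := abel (s + k) s
  rw [add_assoc, sum_range_add] at h2
  have h3 : ∑ i ∈ range s,
      ((s + k).choose i : ℝ) * ((gd (Fin i) i).card * ((s - i - 1 : ℕ) : ℝ) ^ (s + k - i)) =
      ∑ i ∈ range s, ((s + k).choose i : ℝ) * ((i : ℝ) + 1) ^ (i - 1) *
        ((s : ℝ) - i - 1) ^ (s + k - i) := by
    refine sum_congr rfl fun i hi => ?_
    rw [mem_range] at hi
    rw [gd_diag, Nat.sub_sub, Nat.cast_sub (by omega)]
    push_cast
    ring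
  rw [h3] at h1
  have h5 := h1.symm.trans h2
  rw [add_comm] at h5
  rw [add_left_cancel h5, ← sum_range_reflect]
  refine sum_congr rfl fun j hj => ?_
  rw [mem_range] at hj
  have e1 : s + (k + 1 - 1 - j) = s + k - j := by omega
  have e2 : s + k - (s + k - j) = j := by omega
  rw [e1, e2, Nat.choose_symm (by omega), Nat.cast_sub (by omega), ← mul_pow]
  push_cast
  congr 2
  · congr 1; ring
  · ring

/-- `p_{n;≤n-k}/(n+1)^{n-1} → Σ_{i=0}^k ((-1)^i(k+1-i)^i/i!) e^{-i}`
as `n → ∞`. -/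
theorem stmt19 (k : ℕ) :
    Filter.Tendsto
      (fun n : ℕ => (pLe n (n - k) : ℝ) / ((n : ℝ) + 1) ^ (n - 1))
      Filter.atTop
      (nhds (∑ i ∈ Finset.range (k + 1),
        (-1 : ℝ) ^ i * ((k : ℝ) + 1 - i) ^ i / i.factorial * Real.exp (-(i : ℝ)))) := by
  have h := tendsto_finsetSum (Finset.range (k + 1))
    (fun j _ => (lim_term j).mul_const ((-1 : ℝ) ^ j * ((k : ℝ) + 1 - j) ^ j))
  have e : ∀ i ∈ Finset.range (k + 1), (-1 : ℝ) ^ i * ((k : ℝ) + 1 - i) ^ i / i.factorial *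
      Real.exp (-(i : ℝ)) = Real.exp (-(i : ℝ)) / i.factorial *
        ((-1 : ℝ) ^ i * ((k : ℝ) + 1 - i) ^ i) := fun i _ => by ring
  rw [Finset.sum_congr rfl e]
  refine h.congr' ?_
  filter_upwards [Filter.eventually_ge_atTop k] with n hn
  rw [pLe_formula n k hn, Finset.sum_div]
  exact Finset.sum_congr rfl fun i _ => by ring
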